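/- arXiv:1708.03909 — 7 statements merged into one kernel-verified Lean document; each statement's English description precedes it below -/
import Mathlib

section
/- Let p : ℝ → ℝ be infinitely differentiable such that p and all of its derivatives are bounded on ℝ, and let u : ℝ → ℝ be a Schwartz function. Then ∫_ℝ p(x)·u(x)·u''''(x) dx = ∫_ℝ p(x)·(u''(x))² dx − 2·∫_ℝ p''(x)·(u'(x))² dx + (1/2)·∫_ℝ p''''(x)·(u(x))² dx. -/
open MeasureTheory

/-- Iterated derivatives of a Schwartz function are Schwartz functions. -/
theorem exists_schwartzMap_eq_iteratedDeriv (u : SchwartzMap ℝ ℝ) (n : ℕ) :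
    ∃ v : SchwartzMap ℝ ℝ, (v : ℝ → ℝ) = iteratedDeriv n (u : ℝ → ℝ) := by
  induction n with
  | zero => exact ⟨u, by simp⟩
  | succ n ih =>
    obtain ⟨v, hv⟩ := ih
    refine ⟨SchwartzMap.derivCLM ℝ ℝ v, ?_⟩
    ext x
    rw [SchwartzMap.derivCLM_apply, hv, iteratedDeriv_succ]

theorem hasDerivAt_iteratedDeriv {f : ℝ → ℝ} (hf : ContDiff ℝ (⊤ : ℕ∞) f) (n : ℕ) (x : ℝ) :
    HasDerivAt (iteratedDeriv n f) (iteratedDeriv (n + 1) f x) x := by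
  rw [iteratedDeriv_succ]
  exact (hf.differentiable_iteratedDeriv n (by exact_mod_cast WithTop.coe_lt_top n) x).hasDerivAt

theorem integrable_iteratedDeriv_mul_mul {p : ℝ → ℝ} (hp : ContDiff ℝ (⊤ : ℕ∞) p)
    (hpb : ∀ n : ℕ, ∃ C : ℝ, ∀ x : ℝ, |iteratedDeriv n p x| ≤ C)
    (u : SchwartzMap ℝ ℝ) (k i j : ℕ) :
    Integrable fun x : ℝ =>
      iteratedDeriv k p x * (iteratedDeriv i (u : ℝ → ℝ) x * iteratedDeriv j (u : ℝ → ℝ) x) := by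
  obtain ⟨v, hv⟩ := exists_schwartzMap_eq_iteratedDeriv u i
  obtain ⟨w, hw⟩ := exists_schwartzMap_eq_iteratedDeriv u j
  obtain ⟨C, hC⟩ := hpb k
  rw [← hv, ← hw]
  have hvw : Integrable fun x : ℝ => v x * w x :=
    w.integrable.bdd_mul v.continuous.aestronglyMeasurable
      (.of_forall fun x => v.toBoundedContinuousFunction.norm_coe_le_norm x)
  have hpc : Continuous (iteratedDeriv k p) :=
    hp.continuous_iteratedDeriv k (by exact_mod_cast le_top)
  exact hvw.bdd_mul hpc.aestronglyMeasurable (.of_forall hC)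

/-- Weighted integration-by-parts identity for the parabolic regularization term `u_{4x}`:
for a smooth weight `p` with all derivatives bounded and a Schwartz function `u`,
`∫ p u u'''' = ∫ p (u'')² − 2 ∫ p'' (u')² + (1/2) ∫ p'''' u²`. -/
theorem weighted_fourth_derivative_identity
    (p : ℝ → ℝ) (hp : ContDiff ℝ (⊤ : ℕ∞) p)
    (hpb : ∀ n : ℕ, ∃ C : ℝ, ∀ x : ℝ, |iteratedDeriv n p x| ≤ C)
    (u : SchwartzMap ℝ ℝ) :
    (∫ x : ℝ, p x * u x * iteratedDeriv 4 (u : ℝ → ℝ) x) =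
      (∫ x : ℝ, p x * (iteratedDeriv 2 (u : ℝ → ℝ) x) ^ 2)
        - 2 * (∫ x : ℝ, iteratedDeriv 2 p x * (deriv (u : ℝ → ℝ) x) ^ 2)
        + (1 / 2) * (∫ x : ℝ, iteratedDeriv 4 p x * (u x) ^ 2) := by
  have hu := u.smooth (⊤ : ℕ∞)
  have P := hasDerivAt_iteratedDeriv hp
  have U := hasDerivAt_iteratedDeriv hu
  have I := integrable_iteratedDeriv_mul_mul hp hpb u
  have hzero := integral_eq_zero_of_hasDerivAt_of_integrable
    (fun x => (((((((P 0 x).mul ((U 0 x).mul (U 3 x))).sub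
      ((P 1 x).mul ((U 0 x).mul (U 2 x)))).sub
      ((P 0 x).mul ((U 1 x).mul (U 2 x)))).add
      ((P 1 x).mul ((U 1 x).mul (U 1 x)))).add
      ((P 2 x).mul ((U 0 x).mul (U 1 x)))).sub
      (((P 3 x).mul ((U 0 x).mul (U 0 x))).const_mul (1 / 2))).congr_deriv
      (show _ = iteratedDeriv 0 p x * (iteratedDeriv 0 u x * iteratedDeriv 4 u x)
        - iteratedDeriv 0 p x * (iteratedDeriv 2 u x * iteratedDeriv 2 u x)
        + 2 * (iteratedDeriv 2 p x * (iteratedDeriv 1 u x * iteratedDeriv 1 u x))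
        - 1 / 2 * (iteratedDeriv 4 p x * (iteratedDeriv 0 u x * iteratedDeriv 0 u x)) by
        simp only [Pi.mul_apply]
        ring))
    ((((I 0 0 4).sub (I 0 2 2)).add ((I 2 1 1).const_mul 2)).sub ((I 4 0 0).const_mul (1 / 2)))
    ((((((I 0 0 3).sub (I 1 0 2)).sub (I 0 1 2)).add (I 1 1 1)).add (I 2 0 1)).sub
      ((I 3 0 0).const_mul (1 / 2)))
  have D : Integrable fun x =>
      iteratedDeriv 0 p x * (iteratedDeriv 0 u x * iteratedDeriv 4 u x)
        - iteratedDeriv 0 p x * (iteratedDeriv 2 u x * iteratedDeriv 2 u x) :=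
    (I 0 0 4).sub (I 0 2 2)
  rw [integral_sub (D.fun_add ((I 2 1 1).const_mul 2)) ((I 4 0 0).const_mul (1 / 2)),
    integral_add D ((I 2 1 1).const_mul 2), integral_sub (I 0 0 4) (I 0 2 2),
    integral_const_mul, integral_const_mul] at hzero
  simp only [iteratedDeriv_zero, iteratedDeriv_one] at hzero
  simp only [pow_two, mul_assoc]
  linarith
end

section
/- Let δ₀ > 0 and let p : ℝ → ℝ be infinitely differentiable, nondecreasing (so p'(x) ≥ 0 for all x), with p(x) ≥ δ₀ for all x ∈ ℝ, and such that p and all of its derivatives are bounded on ℝ. Then there exist constants C₁, C₂ > 0 such that for every Schwartz function u : ℝ → ℝ, ∫_ℝ p(x)·u(x)·u''''(x) dx ≥ (1/2)·∫_ℝ p(x)·(u''(x))² dx − C₁·∫_ℝ (u(x))² dx − C₂·∫_ℝ p'(x)·(u'(x))² dx. -/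
open MeasureTheory

theorem SchwartzMap.integrable_bounded_mul_mul {b : ℝ → ℝ} (hb : Continuous b) {C : ℝ}
    (hC : ∀ x, |b x| ≤ C) (f g : SchwartzMap ℝ ℝ) :
    Integrable (fun x : ℝ => b x * f x * g x) := by
  refine g.integrable.bdd_mul (c := C * SchwartzMap.seminorm ℝ 0 0 f)
    (hb.mul f.continuous).aestronglyMeasurable (.of_forall fun x => ?_)
  rw [norm_mul]
  exact mul_le_mul (hC x) (f.norm_le_seminorm ℝ x) (norm_nonneg _) ((abs_nonneg _).trans (hC x))

/-- The pointwise estimate behind the lower bound, obtained by completing two squares. -/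
theorem half_weighted_sq_sub_le {δ p q r M N a b c : ℝ} (hδ : 0 < δ) (hp : δ ≤ p) (hq : 0 ≤ q)
    (hqM : q ≤ M) (hrN : |r| ≤ N) :
    1 / 2 * (p * c ^ 2) - (N ^ 2 / δ + 1) * a ^ 2 - (4 * M / δ + 1) * (q * b ^ 2) ≤
      p * c * c + 2 * (q * b * c) + r * a * c := by
  have hcc : δ * c ^ 2 ≤ p * c ^ 2 := by gcongr
  have hr : (r * a) ^ 2 / δ ≤ N ^ 2 / δ * a ^ 2 := by
    rw [mul_pow, mul_div_right_comm, ← sq_abs r]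
    gcongr
  have hqq : 4 * (q * b) ^ 2 / δ ≤ 4 * M / δ * (q * b ^ 2) := by
    have : q * q * b ^ 2 ≤ M * q * b ^ 2 := by gcongr
    rw [div_mul_eq_mul_div]
    refine div_le_div_of_nonneg_right ?_ hδ.le
    linarith
  have h₁ : 0 ≤ δ / 4 * c ^ 2 + 2 * (q * b * c) + 4 * (q * b) ^ 2 / δ := by
    have : δ / 4 * c ^ 2 + 2 * (q * b * c) + 4 * (q * b) ^ 2 / δ
        = (δ * c + 4 * (q * b)) ^ 2 / (4 * δ) := by field_simp; ring
    rw [this]; positivity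
  have h₂ : 0 ≤ δ / 4 * c ^ 2 + r * a * c + (r * a) ^ 2 / δ := by
    have : δ / 4 * c ^ 2 + r * a * c + (r * a) ^ 2 / δ
        = (δ * c + 2 * (r * a)) ^ 2 / (4 * δ) := by field_simp; ring
    rw [this]; positivity
  have h₃ : 0 ≤ q * b ^ 2 := by positivity
  nlinarith [sq_nonneg a]

/-- Two integrations by parts turn `∫ p u u''''` into quadratic terms of order at most two. -/
theorem integral_weight_mul_mul_fourth_deriv {p p₁ p₂ : ℝ → ℝ}
    (hp : ∀ x, HasDerivAt p (p₁ x) x) (hp₁ : ∀ x, HasDerivAt p₁ (p₂ x) x)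
    (hint : ∀ f g : SchwartzMap ℝ ℝ, Integrable (fun x => p x * f x * g x))
    (hint₁ : ∀ f g : SchwartzMap ℝ ℝ, Integrable (fun x => p₁ x * f x * g x))
    (hint₂ : ∀ f g : SchwartzMap ℝ ℝ, Integrable (fun x => p₂ x * f x * g x))
    {u u₁ u₂ u₃ u₄ : SchwartzMap ℝ ℝ} (hu : ∀ x, HasDerivAt u (u₁ x) x)
    (hu₁ : ∀ x, HasDerivAt u₁ (u₂ x) x) (hu₂ : ∀ x, HasDerivAt u₂ (u₃ x) x)
    (hu₃ : ∀ x, HasDerivAt u₃ (u₄ x) x) :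
    ∫ x, p x * u x * u₄ x =
      ∫ x, (p x * u₂ x * u₂ x + 2 * (p₁ x * u₁ x * u₂ x) + p₂ x * u x * u₂ x) := by
  have hrhs : Integrable
      (fun x => p x * u₂ x * u₂ x + 2 * (p₁ x * u₁ x * u₂ x) + p₂ x * u x * u₂ x) :=
    ((hint u₂ u₂).add ((hint₁ u₁ u₂).const_mul 2)).add (hint₂ u u₂)
  rw [← sub_eq_zero, ← integral_sub (hint u u₄) hrhs]
  refine integral_eq_zero_of_hasDerivAt_of_integrable
    (f := fun x => p x * u x * u₃ x - p₁ x * u x * u₂ x - p x * u₁ x * u₂ x)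
    (fun x => ?_) ((hint u u₄).sub hrhs)
    (((hint u u₃).sub (hint₁ u u₂)).sub (hint u₁ u₂))
  refine HasDerivAt.congr_deriv (((((hp x).fun_mul (hu x)).fun_mul (hu₃ x)).fun_sub
    (((hp₁ x).fun_mul (hu x)).fun_mul (hu₂ x))).fun_sub
    (((hp x).fun_mul (hu₁ x)).fun_mul (hu₂ x))) ?_
  ring

/-- Weighted lower bound for the fourth-order regularization term: for a smooth,
nondecreasing weight `p ≥ δ₀ > 0` with all derivatives bounded, there are `C₁, C₂ > 0`
such that for every Schwartz `u`,
`∫ p u u'''' ≥ (1/2) ∫ p (u'')² − C₁ ∫ u² − C₂ ∫ p' (u')²`. -/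
theorem weighted_fourth_derivative_lower_bound
    (δ₀ : ℝ) (hδ₀ : 0 < δ₀)
    (p : ℝ → ℝ) (hp : ContDiff ℝ (⊤ : ℕ∞) p)
    (hmono : ∀ x : ℝ, 0 ≤ deriv p x)
    (hlow : ∀ x : ℝ, δ₀ ≤ p x)
    (hpb : ∀ n : ℕ, ∃ C : ℝ, ∀ x : ℝ, |iteratedDeriv n p x| ≤ C) :
    ∃ C₁ C₂ : ℝ, 0 < C₁ ∧ 0 < C₂ ∧ ∀ u : SchwartzMap ℝ ℝ,
      (∫ x : ℝ, p x * u x * iteratedDeriv 4 (u : ℝ → ℝ) x) ≥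
        (1 / 2) * (∫ x : ℝ, p x * (iteratedDeriv 2 (u : ℝ → ℝ) x) ^ 2)
          - C₁ * (∫ x : ℝ, (u x) ^ 2)
          - C₂ * (∫ x : ℝ, deriv p x * (deriv (u : ℝ → ℝ) x) ^ 2) := by
  obtain ⟨L, hL⟩ := hpb 0
  obtain ⟨M, hM⟩ := hpb 1
  obtain ⟨N, hN⟩ := hpb 2
  simp only [iteratedDeriv_zero] at hL
  simp only [iteratedDeriv_one] at hM
  have hcont (n : ℕ) : Continuous (iteratedDeriv n p) :=
    hp.continuous_iteratedDeriv n (mod_cast le_top)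
  have hderiv (n : ℕ) (x : ℝ) : HasDerivAt (iteratedDeriv n p) (iteratedDeriv (n + 1) p x) x := by
    rw [iteratedDeriv_succ]
    exact (hp.differentiable_iteratedDeriv n (mod_cast ENat.natCast_lt_top n) x).hasDerivAt
  have hM₀ : 0 ≤ M := (abs_nonneg _).trans (hM 0)
  refine ⟨N ^ 2 / δ₀ + 1, 4 * M / δ₀ + 1, by positivity, by positivity, fun u => ?_⟩
  let D := SchwartzMap.derivCLM ℝ ℝ
  have hD (f : SchwartzMap ℝ ℝ) : deriv f = D f := rfl
  have hDd (f : SchwartzMap ℝ ℝ) (x : ℝ) : HasDerivAt f (D f x) x := f.differentiableAt.hasDerivAt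
  have hint := SchwartzMap.integrable_bounded_mul_mul hp.continuous hL
  have hint₁ := SchwartzMap.integrable_bounded_mul_mul
    (by simpa only [iteratedDeriv_one] using hcont 1) hM
  have hint₂ := SchwartzMap.integrable_bounded_mul_mul (hcont 2) hN
  have hsq : Integrable (fun x => u x ^ 2) := by
    simpa [sq] using SchwartzMap.integrable_bounded_mul_mul (b := fun _ => 1) continuous_const
      (fun _ => le_rfl) u u
  have hsq₁ : Integrable (fun x => deriv p x * D u x ^ 2) := by
    simpa only [sq, mul_assoc] using hint₁ (D u) (D u)
  have hsq₂ : Integrable (fun x => p x * D (D u) x ^ 2) := by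
    simpa only [sq, mul_assoc] using hint (D (D u)) (D (D u))
  have hlhs : Integrable
      (fun x => 1 / 2 * (p x * D (D u) x ^ 2) - (N ^ 2 / δ₀ + 1) * u x ^ 2) :=
    (hsq₂.const_mul _).sub (hsq.const_mul _)
  have h₂ : iteratedDeriv 2 (u : ℝ → ℝ) = D (D u) := by
    simp only [iteratedDeriv_succ, iteratedDeriv_zero, hD]
  have h₄ : iteratedDeriv 4 (u : ℝ → ℝ) = D (D (D (D u))) := by
    simp only [iteratedDeriv_succ, iteratedDeriv_zero, hD]
  rw [h₂, h₄, hD, integral_weight_mul_mul_fourth_deriv (p₁ := deriv p) (p₂ := iteratedDeriv 2 p)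
    (by simpa using hderiv 0) (by simpa only [iteratedDeriv_one] using hderiv 1) hint hint₁ hint₂
    (hDd _) (hDd _) (hDd _) (hDd _), ge_iff_le, ← integral_const_mul, ← integral_const_mul,
    ← integral_const_mul, ← integral_sub (hsq₂.const_mul _) (hsq.const_mul _),
    ← integral_sub hlhs (hsq₁.const_mul _)]
  refine integral_mono (hlhs.sub (hsq₁.const_mul _))
    (((hint _ _).add ((hint₁ _ _).const_mul 2)).add (hint₂ _ _)) fun x => ?_
  exact half_weighted_sq_sub_le hδ₀ (hlow x) (hmono x) ((le_abs_self _).trans (hM x)) (hN x)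
end

section
/- Let λ > 0, δ₁ > 0, and let p : ℝ → ℝ be infinitely differentiable, bounded, with 0 ≤ p'(x) ≤ δ₁ for all x ∈ ℝ. Then there exists a constant C₃ > 0 such that for every Schwartz function u : ℝ → ℝ satisfying |u(x)| ≤ λ for all x ∈ ℝ, one has ∫_ℝ p(x)·(u(x))²·u'(x) dx ≥ −C₃·(1 + ‖u‖_{L²(ℝ)}⁶) − (1/2)·∫_ℝ p'(x)·(u'(x))² dx. -/
open MeasureTheory

/-- Integration by parts for `p u² u' = p (u³/3)'`, with `p` bounded of bounded derivative. -/
theorem integral_mul_sq_mul_deriv_schwartz (p : ℝ → ℝ) (hp : ContDiff ℝ 1 p) {C δ : ℝ}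
    (hpb : ∀ x, |p x| ≤ C) (hp' : ∀ x, |deriv p x| ≤ δ) (u : SchwartzMap ℝ ℝ) :
    Integrable (fun x ↦ deriv p x * (u x ^ 3 / 3)) ∧
      ∫ x, p x * u x ^ 2 * deriv u x = -∫ x, deriv p x * (u x ^ 3 / 3) := by
  have hu : Continuous u := u.continuous
  have hpd : Continuous (deriv p) := hp.continuous_deriv le_rfl
  obtain ⟨M, hM⟩ : ∃ M, ∀ x, ‖u x ^ 2‖ ≤ M :=
    ⟨‖u.toBoundedContinuousFunction‖ ^ 2, fun x ↦ by
      rw [norm_pow]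
      exact pow_le_pow_left₀ (norm_nonneg _) (u.toBoundedContinuousFunction.norm_coe_le_norm x) 2⟩
  have hcube : Integrable (fun x ↦ u x ^ 3 / 3) := by
    have h := (u.integrable (μ := volume)).bdd_mul (hu.pow 2).aestronglyMeasurable
      (Filter.Eventually.of_forall hM)
    exact (h.div_const 3).congr (Filter.Eventually.of_forall fun x ↦ by simp; ring)
  have hsq : Integrable (fun x ↦ u x ^ 2 * deriv u x) :=
    ((SchwartzMap.derivCLM ℝ ℝ u).integrable (μ := volume)).bdd_mul
      (hu.pow 2).aestronglyMeasurable (Filter.Eventually.of_forall hM)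
  have hderiv : Integrable (fun x ↦ deriv p x * (u x ^ 3 / 3)) :=
    hcube.bdd_mul hpd.aestronglyMeasurable (Filter.Eventually.of_forall hp')
  refine ⟨hderiv, ?_⟩
  rw [← integral_mul_deriv_eq_deriv_mul_of_integrable (u := p) (u' := deriv p)
    (v := fun x ↦ u x ^ 3 / 3) (v' := fun x ↦ u x ^ 2 * deriv u x)
    (fun x _ ↦ (hp.differentiable one_ne_zero x).hasDerivAt) (fun x _ ↦ ?_)
    (hsq.bdd_mul hp.continuous.aestronglyMeasurable (Filter.Eventually.of_forall hpb)) hderiv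
    (hcube.bdd_mul hp.continuous.aestronglyMeasurable (Filter.Eventually.of_forall hpb))]
  · simp only [mul_assoc]
  · refine (((u.differentiableAt (x := x)).hasDerivAt.pow 3).div_const 3).congr_deriv ?_
    norm_num
    ring

/-- Lower bound for the weighted KdV nonlinearity: if `p` is smooth, bounded, with
`0 ≤ p' ≤ δ₁`, then there is `C₃ > 0` such that for every Schwartz `u` with `|u| ≤ λ`
pointwise, `∫ p u² u' ≥ −C₃ (1 + ‖u‖_{L²}⁶) − (1/2) ∫ p' (u')²`. -/
theorem weighted_kdv_nonlinearity_lower_bound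
    (lam δ₁ : ℝ) (hlam : 0 < lam) (hδ₁ : 0 < δ₁)
    (p : ℝ → ℝ) (hp : ContDiff ℝ (⊤ : ℕ∞) p)
    (hpb : ∃ C : ℝ, ∀ x : ℝ, |p x| ≤ C)
    (hp' : ∀ x : ℝ, 0 ≤ deriv p x ∧ deriv p x ≤ δ₁) :
    ∃ C₃ : ℝ, 0 < C₃ ∧ ∀ u : SchwartzMap ℝ ℝ, (∀ x : ℝ, |u x| ≤ lam) →
      (∫ x : ℝ, p x * (u x) ^ 2 * deriv (u : ℝ → ℝ) x) ≥
        -C₃ * (1 + (Real.sqrt (∫ x : ℝ, (u x) ^ 2)) ^ 6)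
          - (1 / 2) * (∫ x : ℝ, deriv p x * (deriv (u : ℝ → ℝ) x) ^ 2) := by
  obtain ⟨C, hC⟩ := hpb
  refine ⟨δ₁ * lam / 3, by positivity, fun u hu ↦ ?_⟩
  obtain ⟨hint, hparts⟩ := integral_mul_sq_mul_deriv_schwartz p (hp.of_le (by simp)) hC
    (fun x ↦ (abs_of_nonneg (hp' x).1).trans_le (hp' x).2) u
  have hle : ∫ x, deriv p x * (u x ^ 3 / 3) ≤ δ₁ * lam / 3 * ∫ x, u x ^ 2 := by
    rw [← integral_const_mul]
    refine integral_mono hint ((u.memLp 2 volume).integrable_sq.const_mul _) fun x ↦ ?_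
    have h₁ : u x ^ 3 / 3 ≤ lam * u x ^ 2 / 3 := by
      nlinarith [mul_le_mul_of_nonneg_right ((le_abs_self _).trans (hu x)) (sq_nonneg (u x))]
    calc deriv p x * (u x ^ 3 / 3) ≤ deriv p x * (lam * u x ^ 2 / 3) :=
          mul_le_mul_of_nonneg_left h₁ (hp' x).1
      _ ≤ δ₁ * (lam * u x ^ 2 / 3) := mul_le_mul_of_nonneg_right (hp' x).2 (by positivity)
      _ = δ₁ * lam / 3 * u x ^ 2 := by ring
  have hgrad : 0 ≤ ∫ x, deriv p x * deriv u x ^ 2 :=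
    integral_nonneg fun x ↦ mul_nonneg (hp' x).1 (sq_nonneg _)
  have hI : 0 ≤ ∫ x, u x ^ 2 := integral_nonneg fun x ↦ sq_nonneg _
  have hpow : Real.sqrt (∫ x, u x ^ 2) ^ 6 = (∫ x, u x ^ 2) ^ 3 := by
    rw [show 6 = 2 * 3 from rfl, pow_mul, Real.sq_sqrt hI]
  have hcubic : ∫ x, u x ^ 2 ≤ 1 + (∫ x, u x ^ 2) ^ 3 := by
    nlinarith [mul_nonneg hI (sq_nonneg ((∫ x, u x ^ 2) - 1)), sq_nonneg ((∫ x, u x ^ 2) - 1)]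
  have hbound := mul_le_mul_of_nonneg_left hcubic (by positivity : 0 ≤ δ₁ * lam / 3)
  rw [hparts, hpow]
  linarith
end

section
/- Let p : ℝ → ℝ be infinitely differentiable such that p and all of its derivatives are bounded on ℝ, and let u : ℝ → ℝ be a Schwartz function. Then ∫_ℝ p(x)·u(x)·(3·u'(x)·u''(x) + u(x)·u'''(x)) dx = (3/2)·∫_ℝ p'(x)·u(x)·(u'(x))² dx − (1/2)·∫_ℝ p(x)·(u'(x))³ dx − (1/3)·∫_ℝ p'''(x)·(u(x))³ dx. -/
open MeasureTheory

/-- The product of a bounded continuous function and three Schwartz functions is integrable. -/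
theorem integrable_bounded_mul_schwartz {q : ℝ → ℝ} (hq : Continuous q)
    (hqb : ∃ C : ℝ, ∀ x : ℝ, |q x| ≤ C) (f g h : SchwartzMap ℝ ℝ) :
    Integrable fun x => q x * (f x * g x * h x) := by
  obtain ⟨C, hC⟩ := hqb
  have hgh : Integrable fun x => f x * g x * h x := by
    refine h.integrable.bdd_mul (c := SchwartzMap.seminorm ℝ 0 0 f * SchwartzMap.seminorm ℝ 0 0 g)
      (f.continuous.mul g.continuous).aestronglyMeasurable (.of_forall fun x => ?_)
    rw [norm_mul]
    gcongr
    · exact SchwartzMap.norm_le_seminorm ℝ f x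
    · exact SchwartzMap.norm_le_seminorm ℝ g x
  exact hgh.bdd_mul hq.aestronglyMeasurable (.of_forall hC)

/-- Weighted integration-by-parts decomposition of the second-order KdV2 nonlinearity
`3 u_x u_{2x} + u u_{3x}`: for a smooth weight `p` with all derivatives bounded and a
Schwartz function `u`,
`∫ p u (3 u' u'' + u u''') = (3/2) ∫ p' u (u')² − (1/2) ∫ p (u')³ − (1/3) ∫ p''' u³`. -/
theorem weighted_kdv2_nonlinearity_identity
    (p : ℝ → ℝ) (hp : ContDiff ℝ (⊤ : ℕ∞) p)
    (hpb : ∀ n : ℕ, ∃ C : ℝ, ∀ x : ℝ, |iteratedDeriv n p x| ≤ C)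
    (u : SchwartzMap ℝ ℝ) :
    (∫ x : ℝ, p x * u x *
        (3 * deriv (u : ℝ → ℝ) x * iteratedDeriv 2 (u : ℝ → ℝ) x
          + u x * iteratedDeriv 3 (u : ℝ → ℝ) x)) =
      (3 / 2) * (∫ x : ℝ, deriv p x * u x * (deriv (u : ℝ → ℝ) x) ^ 2)
        - (1 / 2) * (∫ x : ℝ, p x * (deriv (u : ℝ → ℝ) x) ^ 3)
        - (1 / 3) * (∫ x : ℝ, iteratedDeriv 3 p x * (u x) ^ 3) := by
  have hu (v : SchwartzMap ℝ ℝ) (x : ℝ) :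
      HasDerivAt v (SchwartzMap.derivCLM ℝ ℝ v x) x := by
    simpa using v.differentiableAt.hasDerivAt
  have hpd (n : ℕ) (x : ℝ) :
      HasDerivAt (iteratedDeriv n p) (iteratedDeriv (n + 1) p x) x := by
    rw [iteratedDeriv_succ]
    exact (hp.differentiable_iteratedDeriv n
      (by exact_mod_cast WithTop.coe_lt_top _)).differentiableAt.hasDerivAt
  have hpc (n : ℕ) : Continuous (iteratedDeriv n p) :=
    continuous_iff_continuousAt.2 fun x => (hpd n x).continuousAt
  have hint (n : ℕ) := integrable_bounded_mul_schwartz (hpc n) (hpb n)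
  set u₁ := SchwartzMap.derivCLM ℝ ℝ u with hu₁
  set u₂ := SchwartzMap.derivCLM ℝ ℝ u₁ with hu₂
  set u₃ := SchwartzMap.derivCLM ℝ ℝ u₂ with hu₃
  have e₁ : deriv (u : ℝ → ℝ) = u₁ := funext fun x => (hu u x).deriv
  have e₂ : iteratedDeriv 2 (u : ℝ → ℝ) = u₂ := by
    rw [iteratedDeriv_succ, iteratedDeriv_one, e₁]
    exact funext fun x => (hu u₁ x).deriv
  have e₃ : iteratedDeriv 3 (u : ℝ → ℝ) = u₃ := by
    rw [iteratedDeriv_succ, e₂]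
    exact funext fun x => (hu u₂ x).deriv
  rw [e₁, e₂, e₃, ← iteratedDeriv_one (f := p)]
  have hL : Integrable fun x => p x * u x * (3 * u₁ x * u₂ x + u x * u₃ x) := by
    refine (((hint 0 u u₁ u₂).const_mul 3).add (hint 0 u u u₃)).congr (.of_forall fun x => ?_)
    simp only [iteratedDeriv_zero, Pi.add_apply]
    ring
  have hA : Integrable fun x => iteratedDeriv 1 p x * u x * u₁ x ^ 2 := by
    convert hint 1 u u₁ u₁ using 2 with x
    ring
  have hB : Integrable fun x => p x * u₁ x ^ 3 := by
    convert hint 0 u₁ u₁ u₁ using 2 with x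
    rw [iteratedDeriv_zero]
    ring
  have hC : Integrable fun x => iteratedDeriv 3 p x * u x ^ 3 := by
    convert hint 3 u u u using 2 with x
    ring
  have hR := ((hA.const_mul (3 / 2)).sub (hB.const_mul (1 / 2))).sub (hC.const_mul (1 / 3))
  have hG : Integrable fun x => iteratedDeriv 0 p x * (u x * u x * u₂ x)
      + 1 / 2 * (iteratedDeriv 0 p x * (u x * u₁ x * u₁ x))
      - iteratedDeriv 1 p x * (u x * u x * u₁ x)
      + 1 / 3 * (iteratedDeriv 2 p x * (u x * u x * u x)) :=
    (((hint 0 u u u₂).add ((hint 0 u u₁ u₁).const_mul (1 / 2))).sub (hint 1 u u u₁)).add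
      ((hint 2 u u u).const_mul (1 / 3))
  have key := integral_eq_zero_of_hasDerivAt_of_integrable (fun x => by
    have d := (((((hpd 0 x).mul (((hu u x).mul (hu u x)).mul (hu u₂ x)))).add
      (((hpd 0 x).mul (((hu u x).mul (hu u₁ x)).mul (hu u₁ x))).const_mul (1 / 2))).sub
      ((hpd 1 x).mul (((hu u x).mul (hu u x)).mul (hu u₁ x)))).add
      (((hpd 2 x).mul (((hu u x).mul (hu u x)).mul (hu u x))).const_mul (1 / 3))
    refine d.congr_deriv (g' := p x * u x * (3 * u₁ x * u₂ x + u x * u₃ x)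
      - (3 / 2 * (iteratedDeriv 1 p x * u x * u₁ x ^ 2) - 1 / 2 * (p x * u₁ x ^ 3)
        - 1 / 3 * (iteratedDeriv 3 p x * u x ^ 3))) ?_
    simp only [← hu₁, ← hu₂, ← hu₃, iteratedDeriv_zero, Pi.mul_apply, zero_add, Nat.reduceAdd]
    ring) (hL.sub hR) hG
  rw [integral_sub' hL hR,
    integral_sub' ((hA.const_mul (3 / 2)).sub (hB.const_mul (1 / 2))) (hC.const_mul (1 / 3)),
    integral_sub' (hA.const_mul (3 / 2)) (hB.const_mul (1 / 2))] at key
  simp only [integral_const_mul] at key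
  linarith
end

section
/- Let p : ℝ → ℝ be infinitely differentiable such that p and all of its derivatives are bounded on ℝ, let λ > 0 and ε > 0. Then there exist constants C₁ ≥ 0 and C₂ ≥ 0 such that for every Schwartz function u : ℝ → ℝ satisfying |u(x)| ≤ λ for all x ∈ ℝ, one has ∫_ℝ p(x)·u(x)·(3·u'(x)·u''(x) + u(x)·u'''(x)) dx ≥ −ε·∫_ℝ (u''(x))² dx − C₁·∫_ℝ (u'(x))² dx − C₂·∫_ℝ (u(x))² dx. -/
open MeasureTheory

/-- A Schwartz function on the line is bounded. -/
lemma SchwartzMap.exists_abs_le (v : SchwartzMap ℝ ℝ) : ∃ C : ℝ, ∀ x, |v x| ≤ C := by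
  obtain ⟨C, hC⟩ := v.decay 0 0
  exact ⟨C, fun x => by simpa using hC.2 x⟩

/-- A continuous bounded function times two Schwartz functions is integrable. -/
lemma SchwartzMap.integrable_bdd_mul_mul {f : ℝ → ℝ} (hf : Continuous f) {C : ℝ}
    (hC : ∀ x, |f x| ≤ C) (v w : SchwartzMap ℝ ℝ) :
    Integrable (fun x => f x * v x * w x) := by
  obtain ⟨B, hB⟩ := v.exists_abs_le
  refine Integrable.bdd_mul (c := C * B) w.integrable
    (hf.mul v.continuous).aestronglyMeasurable (.of_forall fun x => ?_)
  rw [Real.norm_eq_abs, abs_mul]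
  exact mul_le_mul (hC x) (hB x) (abs_nonneg _) ((abs_nonneg _).trans (hC x))

/-- A continuous bounded function times three Schwartz functions is integrable. -/
lemma SchwartzMap.integrable_bdd_mul_mul_mul {f : ℝ → ℝ} (hf : Continuous f) {C : ℝ}
    (hC : ∀ x, |f x| ≤ C) (u v w : SchwartzMap ℝ ℝ) :
    Integrable (fun x => f x * u x * v x * w x) := by
  obtain ⟨B, hB⟩ := u.exists_abs_le
  refine SchwartzMap.integrable_bdd_mul_mul (f := fun x => f x * u x) (C := C * B)
    (hf.mul u.continuous) (fun x => ?_) v w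
  rw [abs_mul]
  exact mul_le_mul (hC x) (hB x) (abs_nonneg _) ((abs_nonneg _).trans (hC x))

/-- A Schwartz function is square integrable. -/
lemma SchwartzMap.integrable_sq (v : SchwartzMap ℝ ℝ) : Integrable (fun x => v x ^ 2) := by
  have h := SchwartzMap.integrable_bdd_mul_mul (f := fun _ => 1) continuous_const
    (C := 1) (by simp) v v
  exact h.congr (.of_forall fun x => by simp [sq])

/-- Young's inequality for a product with a bounded coefficient. -/
lemma neg_young_le_mul_mul {c C a b ε : ℝ} (hc : |c| ≤ C) (hε : 0 < ε) :
    -(ε / 2) * b ^ 2 - C ^ 2 / (2 * ε) * a ^ 2 ≤ c * a * b := by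
  have h1 : c ^ 2 ≤ C ^ 2 := sq_le_sq' (abs_le.1 hc).1 (abs_le.1 hc).2
  have h2 : c ^ 2 / (2 * ε) * a ^ 2 ≤ C ^ 2 / (2 * ε) * a ^ 2 := by gcongr
  have h3 : c * a * b + ε / 2 * b ^ 2 + c ^ 2 / (2 * ε) * a ^ 2
      = (c * a + ε * b) ^ 2 / (2 * ε) := by
    field_simp
    ring
  have h4 : 0 ≤ (c * a + ε * b) ^ 2 / (2 * ε) := by positivity
  linarith

/-- Lower bound for the weighted second-order KdV2 nonlinearity: for a smooth weight `p`
with all derivatives bounded, `λ > 0` and `ε > 0`, there are `C₁, C₂ ≥ 0` such that for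
every Schwartz `u` with `|u| ≤ λ` pointwise,
`∫ p u (3 u' u'' + u u''') ≥ −ε ∫ (u'')² − C₁ ∫ (u')² − C₂ ∫ u²`. -/
theorem weighted_kdv2_nonlinearity_lower_bound
    (p : ℝ → ℝ) (hp : ContDiff ℝ (⊤ : ℕ∞) p)
    (hpb : ∀ n : ℕ, ∃ C : ℝ, ∀ x : ℝ, |iteratedDeriv n p x| ≤ C)
    (lam ε : ℝ) (hlam : 0 < lam) (hε : 0 < ε) :
    ∃ C₁ C₂ : ℝ, 0 ≤ C₁ ∧ 0 ≤ C₂ ∧ ∀ u : SchwartzMap ℝ ℝ, (∀ x : ℝ, |u x| ≤ lam) →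
      (∫ x : ℝ, p x * u x *
          (3 * deriv (u : ℝ → ℝ) x * iteratedDeriv 2 (u : ℝ → ℝ) x
            + u x * iteratedDeriv 3 (u : ℝ → ℝ) x)) ≥
        -ε * (∫ x : ℝ, (iteratedDeriv 2 (u : ℝ → ℝ) x) ^ 2)
          - C₁ * (∫ x : ℝ, (deriv (u : ℝ → ℝ) x) ^ 2)
          - C₂ * (∫ x : ℝ, (u x) ^ 2) := by
  obtain ⟨P, hP⟩ := hpb 0
  obtain ⟨Q, hQ⟩ := hpb 1
  simp only [iteratedDeriv_zero] at hP
  simp only [iteratedDeriv_one] at hQ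
  have hpd : ∀ x, HasDerivAt p (deriv p x) x := fun x =>
    (hp.differentiable (by simp) x).hasDerivAt
  have hpc' : Continuous (deriv p) := hp.continuous_deriv (by simp)
  refine ⟨(P * lam) ^ 2 / (2 * ε), (Q * lam) ^ 2 / (2 * ε), by positivity, by positivity,
    fun u hu => ?_⟩
  let v := SchwartzMap.derivCLM ℝ ℝ u
  let w := SchwartzMap.derivCLM ℝ ℝ v
  let z := SchwartzMap.derivCLM ℝ ℝ w
  have hv : deriv (u : ℝ → ℝ) = v := by ext x; simp [v]
  have hw : deriv (v : ℝ → ℝ) = w := by ext x; simp [w]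
  have hz : deriv (w : ℝ → ℝ) = z := by ext x; simp [z]
  have hw2 : iteratedDeriv 2 (u : ℝ → ℝ) = w := by
    rw [iteratedDeriv_succ, iteratedDeriv_one, hv, hw]
  have hz3 : iteratedDeriv 3 (u : ℝ → ℝ) = z := by
    rw [iteratedDeriv_succ, hw2, hz]
  rw [hw2, hz3, hv]
  have hud : ∀ x, HasDerivAt u (v x) x := fun x => hv ▸ (u.differentiable x).hasDerivAt
  have hwd : ∀ x, HasDerivAt w (z x) x := fun x => hz ▸ (w.differentiable x).hasDerivAt
  have hFd : ∀ x, HasDerivAt (fun x => p x * u x * u x * w x)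
      (deriv p x * u x * u x * w x + 2 * (p x * u x * v x * w x) + p x * u x * u x * z x)
      x := fun x => by
    refine ((((hpd x).fun_mul (hud x)).fun_mul (hud x)).fun_mul (hwd x)).congr_deriv ?_
    ring
  have iQ := SchwartzMap.integrable_bdd_mul_mul_mul hpc' hQ u u w
  have iP := SchwartzMap.integrable_bdd_mul_mul_mul hp.continuous hP u v w
  have iZ := SchwartzMap.integrable_bdd_mul_mul_mul hp.continuous hP u u z
  have iF' := (iQ.add (iP.const_mul 2)).add iZ
  have h0 := integral_eq_zero_of_hasDerivAt_of_integrable hFd iF'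
    (SchwartzMap.integrable_bdd_mul_mul_mul hp.continuous hP u u w)
  have iK : Integrable (fun x => p x * u x * v x * w x - deriv p x * u x * u x * w x) :=
    iP.sub iQ
  have hJ : (∫ x : ℝ, p x * u x * (3 * v x * w x + u x * z x)) =
      ∫ x : ℝ, (p x * u x * v x * w x - deriv p x * u x * u x * w x) := by
    rw [← sub_eq_zero, ← integral_sub _ iK, ← h0]
    · congr 1
      ext x
      ring
    · exact ((iP.const_mul 3).add iZ).congr (.of_forall fun x => by
        simp only [Pi.add_apply]
        ring)
  have iw := w.integrable_sq.const_mul (-ε)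
  have iv := v.integrable_sq.const_mul ((P * lam) ^ 2 / (2 * ε))
  have iu := u.integrable_sq.const_mul ((Q * lam) ^ 2 / (2 * ε))
  have iwv : Integrable
      (fun x => -ε * w x ^ 2 - (P * lam) ^ 2 / (2 * ε) * v x ^ 2) := iw.sub iv
  rw [hJ, ge_iff_le, ← integral_const_mul, ← integral_const_mul, ← integral_const_mul,
    ← integral_sub iw iv, ← integral_sub iwv iu]
  refine integral_mono (iwv.sub iu) iK fun x => ?_
  have hPu : |p x * u x| ≤ P * lam := by
    rw [abs_mul]
    exact mul_le_mul (hP x) (hu x) (abs_nonneg _) ((abs_nonneg _).trans (hP x))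
  have hQu : |-(deriv p x * u x)| ≤ Q * lam := by
    rw [abs_neg, abs_mul]
    exact mul_le_mul (hQ x) (hu x) (abs_nonneg _) ((abs_nonneg _).trans (hQ x))
  have h1 := neg_young_le_mul_mul (a := v x) (b := w x) hPu hε
  have h2 := neg_young_le_mul_mul (a := u x) (b := w x) hQu hε
  simp only
  linarith
end

section
/- There exists a constant C > 0 such that for all Schwartz functions u, φ : ℝ → ℝ, |∫_ℝ u(x)·u'(x)·φ(x) dx| ≤ C·‖u‖_{L²(ℝ)}^{3/2}·(‖u‖²_{L²(ℝ)} + ‖u'‖²_{L²(ℝ)})^{1/4}·(‖φ‖²_{L²(ℝ)} + ‖φ'‖²_{L²(ℝ)})^{1/2}. -/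
open MeasureTheory

namespace SchwartzMap

/-- The **Cauchy–Schwarz inequality** for real-valued Schwartz functions. -/
theorem integral_norm_mul_norm_le_sqrt_mul_sqrt (f g : SchwartzMap ℝ ℝ) :
    ∫ x, ‖f x‖ * ‖g x‖ ≤ √(∫ x, f x ^ 2) * √(∫ x, g x ^ 2) := by
  have h := integral_mul_norm_le_Lp_mul_Lq (μ := volume) Real.HolderConjugate.two_two
    (f.memLp (ENNReal.ofReal 2)) (g.memLp (ENNReal.ofReal 2))
  simpa [Real.sqrt_eq_rpow] using h

/-- The pointwise product of a Schwartz function with itself has derivative `2 f f'`. -/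
theorem hasDerivAt_pairing_mul_self (f : SchwartzMap ℝ ℝ) (x : ℝ) :
    HasDerivAt (pairing (ContinuousLinearMap.mul ℝ ℝ) f f) (2 * (f x * deriv f x)) x := by
  refine ((f.hasDerivAt x).mul (f.hasDerivAt x)).congr_deriv ?_
  ring

/-- Agmon's inequality (with a non-optimal constant) for Schwartz functions. -/
theorem sq_le_two_mul_sqrt_mul_sqrt_deriv (f : SchwartzMap ℝ ℝ) (x : ℝ) :
    f x ^ 2 ≤ 2 * (√(∫ y, f y ^ 2) * √(∫ y, deriv f y ^ 2)) := by
  have hint : Integrable fun y ↦ 2 * (f y * deriv f y) :=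
    (pairing (ContinuousLinearMap.mul ℝ ℝ) f (derivCLM ℝ ℝ f)).integrable.const_mul 2
  have hftc := integral_Iic_of_hasDerivAt_of_tendsto' (a := x)
    (fun y _ ↦ f.hasDerivAt_pairing_mul_self y) hint.integrableOn
    ((tendsto_cocompact _).mono_left atBot_le_cocompact)
  calc f x ^ 2 = ∫ y in Set.Iic x, 2 * (f y * deriv f y) := by
        rw [hftc]; simp [sq]
    _ ≤ ∫ y in Set.Iic x, ‖2 * (f y * deriv f y)‖ :=
        (Real.le_norm_self _).trans (norm_integral_le_integral_norm _)
    _ ≤ ∫ y, ‖2 * (f y * deriv f y)‖ :=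
        setIntegral_le_integral hint.norm (.of_forall fun _ ↦ norm_nonneg _)
    _ = 2 * ∫ y, ‖f y‖ * ‖derivCLM ℝ ℝ f y‖ := by
        simp [integral_const_mul]
    _ ≤ _ := by
        gcongr
        exact f.integral_norm_mul_norm_le_sqrt_mul_sqrt (derivCLM ℝ ℝ f)

/-- A **Ladyzhenskaya-type inequality** in dimension one, for Schwartz functions. -/
theorem integral_sq_sq_le (f : SchwartzMap ℝ ℝ) :
    ∫ x, (f x ^ 2) ^ 2 ≤ 2 * (√(∫ x, f x ^ 2) ^ 3 * √(∫ x, deriv f x ^ 2)) := by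
  let P := pairing (ContinuousLinearMap.mul ℝ ℝ) f f
  have hP (x : ℝ) : P x = f x ^ 2 := by simp [P, sq]
  have hf : Integrable fun x ↦ f x ^ 2 := by
    simpa only [← hP] using! P.integrable (μ := volume)
  have hf4 : Integrable fun x ↦ (f x ^ 2) ^ 2 := by
    simpa only [← hP, sq (P _)] using!
      (pairing (ContinuousLinearMap.mul ℝ ℝ) P P).integrable (μ := volume)
  calc ∫ x, (f x ^ 2) ^ 2
      ≤ ∫ x, 2 * (√(∫ y, f y ^ 2) * √(∫ y, deriv f y ^ 2)) * f x ^ 2 := by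
        refine integral_mono hf4 (hf.const_mul _) fun x ↦ ?_
        dsimp only
        rw [sq (f x ^ 2)]
        gcongr
        exact f.sq_le_two_mul_sqrt_mul_sqrt_deriv x
    _ = 2 * (√(∫ y, f y ^ 2) * √(∫ y, deriv f y ^ 2)) * √(∫ y, f y ^ 2) ^ 2 := by
        rw [integral_const_mul, Real.sq_sqrt (integral_nonneg fun x ↦ sq_nonneg (f x))]
    _ = _ := by ring

theorem integral_mul_deriv_mul_eq (f g : SchwartzMap ℝ ℝ) :
    ∫ x, f x * deriv f x * g x = -(1 / 2) * ∫ x, deriv g x * f x ^ 2 := by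
  have h := integral_mul_deriv_eq_neg_deriv_mul g (pairing (ContinuousLinearMap.mul ℝ ℝ) f f)
  have hL : ∫ x, g x * deriv (pairing (ContinuousLinearMap.mul ℝ ℝ) f f) x
      = 2 * ∫ x, f x * deriv f x * g x := by
    rw [← integral_const_mul]
    refine integral_congr_ae (.of_forall fun x ↦ ?_)
    dsimp only
    rw [(f.hasDerivAt_pairing_mul_self x).deriv]
    ring
  simp only [hL, pairing_apply_apply, ContinuousLinearMap.mul_apply', ← sq] at h
  linarith

theorem abs_integral_mul_deriv_mul_le (f g : SchwartzMap ℝ ℝ) :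
    |∫ x, f x * deriv f x * g x| ≤
      √(∫ x, f x ^ 2) ^ ((3 : ℝ) / 2) * √√(∫ x, deriv f x ^ 2) * √(∫ x, deriv g x ^ 2) := by
  set A := √(∫ x, f x ^ 2) with hA
  set B := √(∫ x, deriv f x ^ 2) with hB
  have hA0 : 0 ≤ A := Real.sqrt_nonneg _
  have h4 : √(∫ x, (f x ^ 2) ^ 2) ≤ 2 * (A ^ ((3 : ℝ) / 2) * √B) := by
    refine Real.sqrt_le_iff.2 ⟨by positivity, f.integral_sq_sq_le.trans ?_⟩
    rw [← hA, ← hB, mul_pow, mul_pow, Real.sq_sqrt (Real.sqrt_nonneg _),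
      ← Real.rpow_mul_natCast hA0]
    norm_num
    gcongr
    norm_num
  have hcs := integral_norm_mul_norm_le_sqrt_mul_sqrt (derivCLM ℝ ℝ g)
    (pairing (ContinuousLinearMap.mul ℝ ℝ) f f)
  simp only [derivCLM_apply, pairing_apply_apply, ContinuousLinearMap.mul_apply', ← sq] at hcs
  calc |∫ x, f x * deriv f x * g x| = 1 / 2 * |∫ x, deriv g x * f x ^ 2| := by
        rw [integral_mul_deriv_mul_eq, abs_mul]; norm_num
    _ ≤ 1 / 2 * ∫ x, ‖deriv g x‖ * ‖f x ^ 2‖ := by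
        gcongr
        simp_rw [← norm_mul]
        exact abs_integral_le_integral_abs
    _ ≤ 1 / 2 * (√(∫ x, deriv g x ^ 2) * (2 * (A ^ ((3 : ℝ) / 2) * √B))) := by
        gcongr
        exact hcs.trans (by gcongr)
    _ = _ := by ring

end SchwartzMap

/-- Dual formulation of the estimate `‖u u_x‖_{H⁻¹} ≤ C ‖u‖_{L²}^{3/2} ‖u‖_{H¹}^{1/2}`:
there is `C > 0` such that for all Schwartz `u, φ`,
`|∫ u u' φ| ≤ C ‖u‖_{L²}^{3/2} (‖u‖_{L²}² + ‖u'‖_{L²}²)^{1/4} (‖φ‖_{L²}² + ‖φ'‖_{L²}²)^{1/2}`. -/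
theorem nonlinear_term_duality_bound :
    ∃ C : ℝ, 0 < C ∧ ∀ u φ : SchwartzMap ℝ ℝ,
      |∫ x : ℝ, u x * deriv (u : ℝ → ℝ) x * φ x| ≤
        C * (Real.sqrt (∫ x : ℝ, (u x) ^ 2)) ^ ((3 : ℝ) / 2)
          * ((Real.sqrt (∫ x : ℝ, (u x) ^ 2)) ^ 2
              + (Real.sqrt (∫ x : ℝ, (deriv (u : ℝ → ℝ) x) ^ 2)) ^ 2) ^ ((1 : ℝ) / 4)
          * ((Real.sqrt (∫ x : ℝ, (φ x) ^ 2)) ^ 2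
              + (Real.sqrt (∫ x : ℝ, (deriv (φ : ℝ → ℝ) x) ^ 2)) ^ 2) ^ ((1 : ℝ) / 2) := by
  refine ⟨1, one_pos, fun u φ ↦ (u.abs_integral_mul_deriv_mul_le φ).trans ?_⟩
  rw [one_mul, ← Real.sqrt_eq_rpow]
  gcongr
  · rw [Real.sqrt_eq_rpow (√_)]
    set B := √(∫ x, deriv u x ^ 2)
    have hB : B ^ ((1 : ℝ) / 2) = (B ^ 2) ^ ((1 : ℝ) / 4) := by
      rw [← Real.rpow_natCast_mul (show 0 ≤ B from Real.sqrt_nonneg _)]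
      congr 1
      norm_num
    rw [hB]
    gcongr
    exact le_add_of_nonneg_left (sq_nonneg _)
  · refine (Real.sq_sqrt (integral_nonneg fun x ↦ sq_nonneg _)).ge.trans ?_
    exact le_add_of_nonneg_left (sq_nonneg _)
end

section
/- Let θ : ℝ → ℝ be continuous with θ(ξ) = 1 for ξ ∈ [0,1], 0 ≤ θ(ξ) ≤ 1 for all ξ, and θ(ξ) = 0 for ξ ≥ 2; let m > 0 and let u : ℝ → ℝ be a Schwartz function. Define b(u)(x) = θ(u'(x)²/m)·u(x)·u'(x) + θ(u'''(x)²/m)·u(x)·u'''(x) + 3·θ(‖u'·u''‖²_{L²(ℝ)}/m)·u'(x)·u''(x). Then ‖b(u)‖_{L²(ℝ)} ≤ 2·√(2m)·‖u‖_{L²(ℝ)} + 3·√(2m). -/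
open MeasureTheory

/-- Minkowski's inequality in `L²`, in a form that requires no measurability of the dominated
function. -/
theorem sqrt_integral_sq_le_add_of_abs_le {α : Type*} [MeasurableSpace α] {μ : Measure α}
    {b f g : α → ℝ} (hf : MemLp f 2 μ) (hg : MemLp g 2 μ)
    (hb : ∀ x, |b x| ≤ |f x| + |g x|) :
    Real.sqrt (∫ x, b x ^ 2 ∂μ) ≤
      Real.sqrt (∫ x, f x ^ 2 ∂μ) + Real.sqrt (∫ x, g x ^ 2 ∂μ) := by
  have hf2 := hf.integrable_sq
  have hg2 := hg.integrable_sq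
  have hfg : Integrable (fun x => |f x| * |g x|) μ := hf.abs.integrable_mul hg.abs
  have hCS : ∫ x, |f x| * |g x| ∂μ ≤
      Real.sqrt (∫ x, f x ^ 2 ∂μ) * Real.sqrt (∫ x, g x ^ 2 ∂μ) := by
    have h := integral_mul_le_Lp_mul_Lq_of_nonneg Real.HolderConjugate.two_two
      (μ := μ) (f := fun x => |f x|) (g := fun x => |g x|)
      (Filter.Eventually.of_forall fun x => abs_nonneg _)
      (Filter.Eventually.of_forall fun x => abs_nonneg _)
      (by rw [ENNReal.ofReal_ofNat]; exact hf.abs)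
      (by rw [ENNReal.ofReal_ofNat]; exact hg.abs)
    simpa [Real.sqrt_eq_rpow] using h
  have hmono : ∫ x, b x ^ 2 ∂μ ≤ ∫ x, (f x ^ 2 + 2 * (|f x| * |g x|) + g x ^ 2) ∂μ := by
    refine integral_mono_of_nonneg (Filter.Eventually.of_forall fun x => sq_nonneg _)
      ((hf2.add (hfg.const_mul 2)).add hg2) (Filter.Eventually.of_forall fun x => ?_)
    have h := pow_le_pow_left₀ (abs_nonneg _) (hb x) 2
    rw [sq_abs] at h
    calc b x ^ 2 ≤ (|f x| + |g x|) ^ 2 := h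
      _ = |f x| ^ 2 + 2 * (|f x| * |g x|) + |g x| ^ 2 := by ring
      _ = _ := by rw [sq_abs, sq_abs]
  have hsum : ∫ x, (f x ^ 2 + 2 * (|f x| * |g x|) + g x ^ 2) ∂μ =
      ∫ x, f x ^ 2 ∂μ + 2 * ∫ x, |f x| * |g x| ∂μ + ∫ x, g x ^ 2 ∂μ := by
    have hf2fg : Integrable (fun x => f x ^ 2 + 2 * (|f x| * |g x|)) μ :=
      hf2.add (hfg.const_mul 2)
    rw [integral_add hf2fg hg2, integral_add hf2 (hfg.const_mul 2),
      integral_const_mul]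
  refine Real.sqrt_le_iff.2 ⟨by positivity, ?_⟩
  have h1 := Real.sq_sqrt (integral_nonneg (μ := μ) fun x => sq_nonneg (f x))
  have h2 := Real.sq_sqrt (integral_nonneg (μ := μ) fun x => sq_nonneg (g x))
  nlinarith

/-- A cutoff vanishing on `[2, ∞)` truncates `s` at height `√(2m)`. -/
theorem cutoff_mul_abs_le_sqrt {θ : ℝ → ℝ} (hθ01 : ∀ ξ : ℝ, 0 ≤ θ ξ ∧ θ ξ ≤ 1)
    (hθ0 : ∀ ξ : ℝ, 2 ≤ ξ → θ ξ = 0) {m : ℝ} (hm : 0 < m) (s : ℝ) :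
    θ (s ^ 2 / m) * |s| ≤ Real.sqrt (2 * m) := by
  rcases le_total 2 (s ^ 2 / m) with h | h
  · simp [hθ0 _ h]
  · rw [div_le_iff₀ hm] at h
    exact (mul_le_of_le_one_left (abs_nonneg s) (hθ01 _).2).trans (Real.abs_le_sqrt h)

/-- Linear growth in L² of the truncated Galerkin drift
`b(u) = θ(u'²/m) u u' + θ(u'''²/m) u u''' + 3 θ(‖u' u''‖²_{L²}/m) u' u''`:
`‖b(u)‖_{L²} ≤ 2√(2m) ‖u‖_{L²} + 3√(2m)`. -/
theorem galerkin_drift_linear_growth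
    (θ : ℝ → ℝ) (hθc : Continuous θ)
    (hθ1 : ∀ ξ : ℝ, ξ ∈ Set.Icc (0 : ℝ) 1 → θ ξ = 1)
    (hθ01 : ∀ ξ : ℝ, 0 ≤ θ ξ ∧ θ ξ ≤ 1)
    (hθ0 : ∀ ξ : ℝ, 2 ≤ ξ → θ ξ = 0)
    (m : ℝ) (hm : 0 < m)
    (u : SchwartzMap ℝ ℝ) :
    Real.sqrt (∫ x : ℝ,
        (θ ((deriv (u : ℝ → ℝ) x) ^ 2 / m) * u x * deriv (u : ℝ → ℝ) x
          + θ ((iteratedDeriv 3 (u : ℝ → ℝ) x) ^ 2 / m) * u x * iteratedDeriv 3 (u : ℝ → ℝ) x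
          + 3 * θ ((∫ y : ℝ, (deriv (u : ℝ → ℝ) y * iteratedDeriv 2 (u : ℝ → ℝ) y) ^ 2) / m)
              * deriv (u : ℝ → ℝ) x * iteratedDeriv 2 (u : ℝ → ℝ) x) ^ 2) ≤
      2 * Real.sqrt (2 * m) * Real.sqrt (∫ x : ℝ, (u x) ^ 2) + 3 * Real.sqrt (2 * m) := by
  let v : SchwartzMap ℝ ℝ := SchwartzMap.derivCLM ℝ ℝ u
  let w : SchwartzMap ℝ ℝ := SchwartzMap.derivCLM ℝ ℝ v
  have hv : deriv (u : ℝ → ℝ) = v := rfl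
  have hw : iteratedDeriv 2 (u : ℝ → ℝ) = w := by
    rw [iteratedDeriv_succ, iteratedDeriv_one]
    rfl
  have hvw : MemLp (fun x => deriv (u : ℝ → ℝ) x * iteratedDeriv 2 (u : ℝ → ℝ) x) 2 := by
    rw [hv, hw]
    exact MemLp.mul (p := ⊤) (q := 2) (w.memLp 2) (v.memLp ⊤)
  set N := ∫ y : ℝ, (deriv (u : ℝ → ℝ) y * iteratedDeriv 2 (u : ℝ → ℝ) y) ^ 2 with hN
  have hN0 : 0 ≤ N := integral_nonneg fun x => sq_nonneg _
  set S := Real.sqrt (2 * m)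
  have hS : 0 ≤ S := Real.sqrt_nonneg _
  refine (sqrt_integral_sq_le_add_of_abs_le ((u.memLp 2).const_mul (2 * S))
    (hvw.const_mul (3 * θ (N / m))) fun x => ?_).trans (add_le_add (le_of_eq ?_) ?_)
  · have hcut (s : ℝ) : |θ (s ^ 2 / m) * u x * s| ≤ S * |u x| := by
      rw [abs_mul, abs_mul, abs_of_nonneg (hθ01 _).1, mul_right_comm]
      exact mul_le_mul_of_nonneg_right (cutoff_mul_abs_le_sqrt hθ01 hθ0 hm s) (abs_nonneg _)
    refine (abs_add_le _ _).trans (add_le_add ((abs_add_le _ _).trans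
      ((add_le_add (hcut _) (hcut _)).trans_eq ?_)) (le_of_eq ?_))
    · rw [abs_mul, abs_of_nonneg (by positivity : 0 ≤ 2 * S)]
      ring
    · rw [mul_assoc]
  · simp only [mul_pow (2 * S)]
    rw [integral_const_mul, Real.sqrt_mul (sq_nonneg _), Real.sqrt_sq (by positivity)]
  · have hθN := (hθ01 (N / m)).1
    simp only [mul_pow (3 * θ (N / m))]
    rw [integral_const_mul, Real.sqrt_mul (sq_nonneg _), Real.sqrt_sq (by positivity), ← hN,
      mul_assoc]
    have h := cutoff_mul_abs_le_sqrt hθ01 hθ0 hm (Real.sqrt N)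
    rw [Real.sq_sqrt hN0, abs_of_nonneg (Real.sqrt_nonneg _)] at h
    exact mul_le_mul_of_nonneg_left h (by norm_num)
end
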